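/- Assume Γ = 2n+1 and assume there exists σ ∈ [1,N] with m_σ even. Then det S = 0. -/

import Mathlib

open Matrix

/-- The entries of the matrix `A_r` read with natural-number indices (zero outside range). -/
def Anat {K : Type} [Field K] {mr Γ : ℕ} (A : Matrix (Fin mr) (Fin Γ) K) (a b : ℕ) : K :=
  if ha : a < mr then (if hb : b < Γ then A ⟨a, ha⟩ ⟨b, hb⟩ else 0) else 0

/-- The block matrix `S`: the diagonal block at `(r,i)` is `[[0, A_r],[A_rᵀ, 0]]`, and the
off-diagonal block at `((r,i),(s,j))` is `[[0,0],[0, E^{r,s}_{i,j}]]` where the matrix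
`E^{r,s}_{i,j}` of size `Γ` is described by the entry function `EΓ (e r s i j) : ℕ → ℕ → K`. -/
def Smat (K : Type) [Field K] (N Γ : ℕ) (kk mm : Fin N → ℕ)
    (A : ∀ r : Fin N, Matrix (Fin (mm r)) (Fin Γ) K)
    (e : ∀ r s : Fin N, Fin (kk r) → Fin (kk s) → K)
    (EΓ : K → ℕ → ℕ → K) :
    Matrix (Σ r : Fin N, Fin (kk r) × Fin (mm r + Γ))
      (Σ r : Fin N, Fin (kk r) × Fin (mm r + Γ)) K :=
  Matrix.of fun x y =>
    if (⟨x.1, x.2.1⟩ : Σ r : Fin N, Fin (kk r)) = ⟨y.1, y.2.1⟩ then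
      (if (x.2.2 : ℕ) < mm x.1 ∧ mm y.1 ≤ (y.2.2 : ℕ) then
        Anat (A x.1) (x.2.2 : ℕ) ((y.2.2 : ℕ) - mm y.1)
      else if mm x.1 ≤ (x.2.2 : ℕ) ∧ (y.2.2 : ℕ) < mm y.1 then
        Anat (A y.1) (y.2.2 : ℕ) ((x.2.2 : ℕ) - mm x.1)
      else 0)
    else
      (if mm x.1 ≤ (x.2.2 : ℕ) ∧ mm y.1 ≤ (y.2.2 : ℕ) then
        EΓ (e x.1 y.1 x.2.1 y.2.1) ((x.2.2 : ℕ) - mm x.1) ((y.2.2 : ℕ) - mm y.1)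
      else 0)

/-- Entry function of the matrix `[[0,0,0],[0,0,v·I_n],[0,v·I_n,0]]` of size `2n+1`
(with diagonal blocks of sizes `1, n, n`). -/
def Ent2n1 (K : Type) [Field K] (n : ℕ) (v : K) (a b : ℕ) : K :=
  if (1 ≤ a ∧ a + n = b) ∨ (1 ≤ b ∧ b + n = a) then v else 0

lemma Matrix.det_eq_zero_of_symm_of_odd_card {R ι : Type*} [CommRing R] [CharP R 2] [Fintype ι]
    [DecidableEq ι] (M : Matrix ι ι R) (hsymm : ∀ i j, M i j = M j i) (hdiag : ∀ i, M i i = 0)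
    (hodd : Odd (Fintype.card ι)) : M.det = 0 := by
  have hterm (π : Equiv.Perm ι) (hπ : π⁻¹ = π) : ∏ i, M (π i) i = 0 := by
    have : Fact (Nat.Prime 2) := ⟨Nat.prime_two⟩
    obtain ⟨a, ha⟩ := Equiv.Perm.exists_fixed_point_of_prime (p := 2) (n := 1) (σ := π)
      hodd.not_two_dvd_nat (by rw [pow_one, sq]; nth_rw 1 [← hπ]; exact inv_mul_cancel π)
    exact Finset.prod_eq_zero (Finset.mem_univ a) (by rw [ha, hdiag])
  have hinv (π : Equiv.Perm ι) : ∏ i, M (π⁻¹ i) i = ∏ i, M (π i) i := by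
    rw [← Equiv.prod_comp π]
    exact Finset.prod_congr rfl fun i _ => by rw [hsymm]; simp
  rw [Matrix.det_apply']
  refine Finset.sum_involution (fun π _ => π⁻¹) (fun π _ => ?_) (fun π _ h hπ => ?_)
    (fun _ _ => Finset.mem_univ _) (fun π _ => inv_inv π)
  · rw [hinv, Equiv.Perm.sign_inv]
    exact CharTwo.add_self_eq_zero _
  · exact h (by rw [hterm π hπ, mul_zero])

lemma Anat_val {K : Type} [Field K] {m Γ : ℕ} (A : Matrix (Fin m) (Fin Γ) K) (a : Fin m)
    (b : Fin Γ) : Anat A a b = A a b := by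
  simp only [Anat, Fin.is_lt, Fin.eta, dif_pos]

/-- A nonzero solution of the homogeneous linear system attached to `Smat`, split into its
components `x` and `y`, makes the determinant vanish. -/
lemma det_Smat_eq_zero {K : Type} [Field K] {n N : ℕ} {kk mm : Fin N → ℕ}
    (A : ∀ r : Fin N, Matrix (Fin (mm r)) (Fin (2 * n + 1)) K)
    (e : ∀ r s : Fin N, Fin (kk r) → Fin (kk s) → K)
    (hediag : ∀ r i, e r r i i = 0)
    (x : ∀ p : Σ r, Fin (kk r), Fin (mm p.1) → K)
    (y : (Σ r, Fin (kk r)) → Fin (2 * n + 1) → K)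
    (hne : ∃ p, x p ≠ 0 ∨ y p ≠ 0)
    (hupper : ∀ p, A p.1 *ᵥ y p = 0)
    (hlower : ∀ p, (A p.1)ᵀ *ᵥ x p +
      ∑ q, e p.1 q.1 p.2 q.2 • (Matrix.of fun a b => Ent2n1 K n 1 a b : Matrix
        (Fin (2 * n + 1)) (Fin (2 * n + 1)) K) *ᵥ y q = 0) :
    (Smat K N (2 * n + 1) kk mm A e (Ent2n1 K n)).det = 0 := by
  rw [← Matrix.exists_mulVec_eq_zero_iff]
  refine ⟨fun z => Fin.append (x ⟨z.1, z.2.1⟩) (y ⟨z.1, z.2.1⟩) z.2.2, fun h => ?_, ?_⟩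
  · obtain ⟨p, hp⟩ := hne
    refine hp.elim (fun hx => hx (funext fun a => ?_)) (fun hy => hy (funext fun b => ?_))
    · simpa using congrFun h ⟨p.1, p.2, Fin.castAdd _ a⟩
    · simpa using congrFun h ⟨p.1, p.2, Fin.natAdd _ b⟩
  have hsum (f : (Σ r : Fin N, Fin (kk r) × Fin (mm r + (2 * n + 1))) → K) :
      ∑ z, f z = ∑ p : Σ r, Fin (kk r), ((∑ a, f ⟨p.1, p.2, Fin.castAdd _ a⟩) +
        ∑ b, f ⟨p.1, p.2, Fin.natAdd _ b⟩) := by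
    simp only [Fintype.sum_sigma, Fintype.sum_prod_type, Fin.sum_univ_add]
  have hEnt (v : K) (a b : ℕ) : Ent2n1 K n v a b = v * Ent2n1 K n 1 a b := by
    simp [Ent2n1]
  have hnle {m : ℕ} (a : Fin m) : ¬ m ≤ a := a.is_lt.not_ge
  funext ⟨r, i, t⟩
  simp only [Matrix.mulVec, dotProduct, hsum, Pi.zero_apply]
  induction t using Fin.addCases with
  | left a =>
    rw [Finset.sum_eq_single ⟨r, i⟩]
    · have := congrFun (hupper ⟨r, i⟩) a
      simpa [Smat, Anat_val, hnle, Matrix.mulVec, dotProduct] using this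
    · intro q _ hq
      simp [Smat, hnle, hq.symm]
    · simp
  | right b =>
    have := congrFun (hlower ⟨r, i⟩) b
    simp only [Matrix.mulVec, dotProduct, Pi.add_apply, Finset.sum_apply, Pi.smul_apply,
      Pi.zero_apply, smul_eq_mul, Matrix.transpose_apply, Matrix.of_apply] at this
    rw [← this, Finset.sum_add_distrib]
    congr 1
    · rw [Finset.sum_eq_single ⟨r, i⟩]
      · simp [Smat, Anat_val]
      · intro q _ hq
        simp [Smat, hnle, hq.symm]
      · simp
    · refine Finset.sum_congr rfl fun q _ => ?_
      rw [Finset.mul_sum]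
      refine Finset.sum_congr rfl fun b' _ => ?_
      by_cases hq : (⟨r, i⟩ : Σ r, Fin (kk r)) = q
      · subst hq
        simp [Smat, hediag]
      · simp [Smat, hq, hEnt (e r q.1 i q.2), mul_assoc]

/-- Proposition 2.2(3): `Γ = 2n+1` and some `σ` with `m_σ` even; then `det S = 0`. -/
theorem detS_case3
    (K : Type) [Field K] [CharP K 2]
    (n N : ℕ) (hn : 0 < n) (hN : 0 < N)
    (kk mm : Fin N → ℕ)
    (hkk : ∀ r, 1 ≤ kk r) (hmm : ∀ r, 1 ≤ mm r ∧ mm r ≤ 2 * n)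
    (A : ∀ r : Fin N, Matrix (Fin (mm r)) (Fin (2 * n + 1)) K)
    (hA : ∀ r s : Fin N, r < s → mm r < mm s ∧
      ∃ τ : Fin (mm r) → Fin (mm s), Function.Injective τ ∧ ∀ a, A r a = A s (τ a))
    (e : ∀ r s : Fin N, Fin (kk r) → Fin (kk s) → K)
    (hesymm : ∀ r s i j, e r s i j = e s r j i)
    (hediag : ∀ r i, e r r i i = 0)
    (hsig : ∃ σ : Fin N, Even (mm σ)) :
    (Smat K N (2 * n + 1) kk mm A e (Ent2n1 K n)).det = 0 := by
  classical
  obtain ⟨σ, hσ⟩ := hsig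
  let i₀ : Fin (kk σ) := ⟨0, hkk σ⟩
  let J : Matrix (Fin (2 * n + 1)) (Fin (2 * n + 1)) K := Matrix.of fun a b => Ent2n1 K n 1 a b
  have hJ (a b) : J a b = J b a := by simp [J, Ent2n1, or_comm]
  have hJ0 (a) : J a a = 0 := by
    simp only [J, Ent2n1, Matrix.of_apply, ite_eq_right_iff]
    omega
  have hdet : (Matrix.fromBlocks 0 (A σ) (A σ)ᵀ J).det = 0 := by
    refine Matrix.det_eq_zero_of_symm_of_odd_card _ ?_ ?_ ?_
    · rintro (a | a) (b | b) <;> simp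
      exact hJ a b
    · rintro (a | a) <;> simp [hJ0]
    · simpa using hσ.add_odd (odd_two_mul_add_one n)
  obtain ⟨w, hw0, hw⟩ := Matrix.exists_mulVec_eq_zero_iff.mpr hdet
  obtain ⟨x₀, u, rfl⟩ : ∃ x₀ u, w = Sum.elim x₀ u := ⟨_, _, (Sum.elim_comp_inl_inr w).symm⟩
  rw [Matrix.fromBlocks_mulVec] at hw
  have hAu : A σ *ᵥ u = 0 := by
    funext a
    simpa using congrFun hw (Sum.inl a)
  have hAx : (A σ)ᵀ *ᵥ x₀ + J *ᵥ u = 0 := by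
    funext b
    simpa using congrFun hw (Sum.inr b)
  by_cases hu : u = 0
  · subst hu
    have hx₀ : x₀ ≠ 0 := by
      rintro rfl
      exact hw0 (by simp)
    refine det_Smat_eq_zero A e hediag
      (fun p => if h : p.1 = σ then (if p.2.1 = 0 then h ▸ x₀ else 0) else 0)
      0 ⟨⟨σ, i₀⟩, Or.inl (by simpa [i₀] using hx₀)⟩ (by simp) ?_
    rintro ⟨r, i⟩
    by_cases hr : r = σ
    · subst hr
      by_cases hi : i.1 = 0
      · simpa [hi] using hAx
      · simp [hi]
    · simp [hr]
  have hker (r : Fin N) (hr : r ≤ σ) : A r *ᵥ u = 0 := by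
    rcases hr.lt_or_eq with hr | rfl
    · obtain ⟨-, τ, -, hτ⟩ := hA r σ hr
      funext a
      simpa [Matrix.mulVec, hτ a] using congrFun hAu (τ a)
    · exact hAu
  have hrange (r : Fin N) : ∃ X, σ ≤ r → (A r)ᵀ *ᵥ X + J *ᵥ u = 0 := by
    by_cases hr : σ ≤ r
    swap
    · exact ⟨0, fun h => absurd h hr⟩
    rcases hr.lt_or_eq with hr | rfl
    · obtain ⟨-, τ, -, hτ⟩ := hA σ r hr
      refine ⟨∑ a, x₀ a • Pi.single (τ a) 1, fun _ => ?_⟩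
      rw [← hAx, Matrix.mulVec_sum]
      congr 1
      funext b
      simp [Matrix.mulVec_smul, Matrix.mulVec, dotProduct, hτ, mul_comm]
    · exact ⟨x₀, fun _ => hAx⟩
  choose X hX using hrange
  -- Fewer equations than unknowns: the rows indexed by `σ` vanish.
  obtain ⟨c, hc0, hc⟩ := Matrix.exists_mulVec_eq_zero_iff.mpr
    (Matrix.det_eq_zero_of_row_eq_zero (A := (Matrix.of fun p q : Σ r, Fin (kk r) =>
      if p.1 < σ then e p.1 q.1 p.2 q.2 else if p.1 = σ then 0 else if p = q then (1 : K) else 0))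
      ⟨σ, i₀⟩ (by simp))
  have hc_gt (p : Σ r, Fin (kk r)) (hp : σ < p.1) : c p = 0 := by
    simpa [Matrix.mulVec, dotProduct, hp.not_gt, hp.ne'] using congrFun hc p
  have hc_lt (p : Σ r, Fin (kk r)) (hp : p.1 < σ) : ∑ q, e p.1 q.1 p.2 q.2 * c q = 0 := by
    simpa [Matrix.mulVec, dotProduct, hp] using congrFun hc p
  obtain ⟨p₀, hp₀⟩ := Function.ne_iff.mp hc0
  refine det_Smat_eq_zero A e hediag (fun p => (∑ q, e p.1 q.1 p.2 q.2 * c q) • X p.1)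
    (fun p => c p • u) ⟨p₀, Or.inr (smul_ne_zero hp₀ hu)⟩ (fun p => ?_) (fun p => ?_)
  · rcases le_or_gt p.1 σ with hp | hp
    · simp [Matrix.mulVec_smul, hker _ hp]
    · simp [hc_gt p hp]
  · have hsum : ∑ q, e p.1 q.1 p.2 q.2 • J *ᵥ (c q • u) =
        (∑ q, e p.1 q.1 p.2 q.2 * c q) • J *ᵥ u := by
      simp [Matrix.mulVec_smul, Finset.sum_smul, mul_smul]
    change _ + ∑ q, e p.1 q.1 p.2 q.2 • J *ᵥ (c q • u) = 0
    rw [hsum, Matrix.mulVec_smul, ← smul_add]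
    rcases lt_or_ge p.1 σ with hp | hp
    · rw [hc_lt p hp, zero_smul]
    · rw [hX _ hp, smul_zero]
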